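/- If N = q^k · n² is an odd perfect number given in Eulerian form whose smallest prime factor u satisfies u ≥ 5, then q < n. -/

import Mathlib

namespace OddPerfect

open Finset

theorem geomSum_mul_eq (r a b : ℕ) :
    ∑ i ∈ range (a * b), r ^ i = (∑ i ∈ range a, r ^ i) * ∑ i ∈ range b, (r ^ a) ^ i := by
  induction b with
  | zero => simp
  | succ b ih =>
    rw [Nat.mul_succ, sum_range_add, ih, sum_range_succ, mul_add, ← pow_mul]
    simp only [pow_add, ← mul_sum]
    ring

/-- The sum `1 + r + ⋯ + r ^ (d - 1)` can only be prime when the number of terms is prime. -/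
theorem prime_of_geomSum_prime {r d : ℕ} (hr : 2 ≤ r) (h : (∑ i ∈ range d, r ^ i).Prime) :
    d.Prime := by
  have mono : ∀ {m n : ℕ}, m < n → ∑ i ∈ range m, r ^ i < ∑ i ∈ range n, r ^ i := by
    intro m n hmn
    refine sum_lt_sum_of_subset (range_subset_range.2 hmn.le) (mem_range.2 hmn) (by simp)
      (by positivity) (by intros; positivity)
  have hd0 : d ≠ 0 := by rintro rfl; simp [Nat.not_prime_zero] at h
  have hd1 : d ≠ 1 := by rintro rfl; simp [Nat.not_prime_one] at h
  by_contra hd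
  obtain ⟨a, had, ha1, ha⟩ := Nat.exists_dvd_of_not_prime2 (by omega) hd
  obtain ⟨b, rfl⟩ := had
  have hdvd : ∑ i ∈ range a, r ^ i ∣ ∑ i ∈ range (a * b), r ^ i := by
    rw [geomSum_mul_eq]
    exact dvd_mul_right _ _
  have h1 := mono (show 1 < a by omega)
  have h2 := mono ha
  simp only [range_one, sum_singleton, pow_zero] at h1
  rcases (Nat.dvd_prime h).1 hdvd with h3 | h3 <;> omega

/-- If `1 + r + ⋯ + r ^ (d - 1)` is a prime `p`, then `d` divides `p - 1`. -/
theorem dvd_sub_one_of_geomSum_eq_prime {r d p : ℕ} (hr : 2 ≤ r) (hp : p.Prime)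
    (h : ∑ i ∈ range d, r ^ i = p) : d ∣ p - 1 := by
  have hd : d.Prime := prime_of_geomSum_prime hr (h ▸ hp)
  have : Fact p.Prime := ⟨hp⟩
  have : Fact d.Prime := ⟨hd⟩
  have hlt : r < p := by
    have : ∑ i ∈ range 2, r ^ i ≤ ∑ i ∈ range d, r ^ i :=
      sum_le_sum_of_subset (range_subset_range.2 hd.two_le)
    simp [sum_range_succ] at this
    omega
  have hr1 : (r : ZMod p) ≠ 1 := by
    intro h1
    have : (r : ZMod p) = ((1 : ℕ) : ZMod p) := by simpa using h1
    rw [ZMod.natCast_eq_natCast_iff'] at this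
    rw [Nat.mod_eq_of_lt hlt, Nat.mod_eq_of_lt hp.one_lt] at this
    omega
  have hpow : (r : ZMod p) ^ d = 1 := by
    have h2 := geom_sum_mul (r : ZMod p) d
    have h3 : ∑ i ∈ range d, (r : ZMod p) ^ i = 0 := by
      have := congrArg (Nat.cast : ℕ → ZMod p) h
      simpa using this
    rw [h3, zero_mul] at h2
    exact (sub_eq_zero.1 h2.symm)
  have ho : orderOf (r : ZMod p) = d := orderOf_eq_prime hpow hr1
  have h0 : (r : ZMod p) ≠ 0 := by
    intro h0
    rw [h0, zero_pow hd.ne_zero] at hpow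
    exact zero_ne_one hpow
  rw [← ho]
  exact orderOf_dvd_of_pow_eq_one (ZMod.pow_card_sub_one_eq_one h0)

/-- If `1 + r + ⋯ + r ^ (d - 1)` is a power of an odd prime `p`, then `p` does not divide `d`. -/
theorem not_dvd_of_geomSum_eq_prime_pow {r d p j : ℕ} (hr : 2 ≤ r) (hp : p.Prime) (hp2 : Odd p)
    (hd : d ≠ 0) (h : ∑ i ∈ range d, r ^ i = p ^ j) : ¬ p ∣ d := by
  rintro ⟨b, rfl⟩
  have hb : b ≠ 0 := by rintro rfl; simp at hd
  set x := r ^ b with hx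
  have hx2 : 2 ≤ x := hr.trans (Nat.le_self_pow hb r)
  have hmul : (∑ i ∈ range b, r ^ i) * ∑ i ∈ range p, x ^ i = p ^ j := by
    rw [← h, mul_comm p b, geomSum_mul_eq]
  obtain ⟨e, -, he⟩ := (Nat.dvd_prime_pow hp).1 (Dvd.intro_left _ hmul)
  have hgt : p < ∑ i ∈ range p, x ^ i := by
    calc p = ∑ i ∈ range p, 1 := by simp
      _ < _ := sum_lt_sum (fun i _ => Nat.one_le_pow _ _ (by omega))
        ⟨1, mem_range.2 hp.one_lt, by rw [pow_one]; omega⟩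
  have he2 : 2 ≤ e := by
    by_contra! hlt
    have : p ^ e ≤ p ^ 1 := Nat.pow_le_pow_right hp.pos (by omega)
    rw [← he, pow_one] at this
    omega
  have : Fact p.Prime := ⟨hp⟩
  have hx1 : (x : ZMod p) = 1 := by
    have h2 := geom_sum_mul (x : ZMod p) p
    have h3 : ∑ i ∈ range p, (x : ZMod p) ^ i = 0 := by
      have := congrArg (Nat.cast : ℕ → ZMod p) he
      simpa [show e ≠ 0 by omega] using this
    rw [h3, zero_mul, ZMod.pow_card] at h2
    exact (sub_eq_zero.1 h2.symm)
  have hdx : (p : ℤ) ∣ (x : ℤ) - 1 := by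
    rw [← ZMod.intCast_zmod_eq_zero_iff_dvd]
    push_cast
    rw [hx1, sub_self]
  obtain ⟨y, hy⟩ := hdx
  have hsq := odd_sq_dvd_geom_sum₂_sub (1 : ℤ) y hp2
  simp only [one_pow, mul_one, ← hy, add_sub_cancel] at hsq
  have hF : (p : ℤ) ^ 2 ∣ ∑ i ∈ range p, (x : ℤ) ^ i := by
    have : p ^ 2 ∣ ∑ i ∈ range p, x ^ i := he ▸ pow_dvd_pow p he2
    exact_mod_cast this
  have hpp : (p : ℤ) ^ 2 ∣ p := by simpa using dvd_sub hF hsq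
  have : p ^ 2 ∣ p := by exact_mod_cast hpp
  have := Nat.le_of_dvd hp.pos this
  nlinarith [hp.two_le]

theorem primorial_mul_lt_pow {h : ℕ} (hh : 1 ≤ h) :
    primorial (2 * h + 1) * ((2 * h + 1) * (h * h + h - 2)) < 25 ^ h := by
  rcases lt_or_ge h 30 with hlt | hge
  · have key {a b : ℕ} (H : primorial (2 * b + 1) * ((2 * b + 1) * (b * b + b - 2)) < 25 ^ a)
        (ha : a ≤ h) (hb : h ≤ b) :
        primorial (2 * h + 1) * ((2 * h + 1) * (h * h + h - 2)) < 25 ^ h :=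
      calc primorial (2 * h + 1) * ((2 * h + 1) * (h * h + h - 2))
          ≤ primorial (2 * b + 1) * ((2 * b + 1) * (b * b + b - 2)) := by
            gcongr
            exact primorial_mono (by omega)
        _ < 25 ^ a := H
        _ ≤ 25 ^ h := Nat.pow_le_pow_right (by norm_num) ha
    have H1 : primorial (2 * 1 + 1) * ((2 * 1 + 1) * (1 * 1 + 1 - 2)) < 25 ^ 1 := by norm_num
    have H2 : primorial (2 * 2 + 1) * ((2 * 2 + 1) * (2 * 2 + 2 - 2)) < 25 ^ 2 := by
      norm_num [primorial, prod_filter, prod_range_succ]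
    have H3 : primorial (2 * 3 + 1) * ((2 * 3 + 1) * (3 * 3 + 3 - 2)) < 25 ^ 3 := by
      norm_num [primorial, prod_filter, prod_range_succ]
    have H4 : primorial (2 * 4 + 1) * ((2 * 4 + 1) * (4 * 4 + 4 - 2)) < 25 ^ 4 := by
      norm_num [primorial, prod_filter, prod_range_succ]
    have H5 : primorial (2 * 5 + 1) * ((2 * 5 + 1) * (5 * 5 + 5 - 2)) < 25 ^ 5 := by
      norm_num [primorial, prod_filter, prod_range_succ]
    have H6 : primorial (2 * 7 + 1) * ((2 * 7 + 1) * (7 * 7 + 7 - 2)) < 25 ^ 6 := by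
      norm_num [primorial, prod_filter, prod_range_succ]
    have H8 : primorial (2 * 9 + 1) * ((2 * 9 + 1) * (9 * 9 + 9 - 2)) < 25 ^ 8 := by
      norm_num [primorial, prod_filter, prod_range_succ]
    have H10 : primorial (2 * 12 + 1) * ((2 * 12 + 1) * (12 * 12 + 12 - 2)) < 25 ^ 10 := by
      norm_num [primorial, prod_filter, prod_range_succ]
    have H13 : primorial (2 * 16 + 1) * ((2 * 16 + 1) * (16 * 16 + 16 - 2)) < 25 ^ 13 := by
      norm_num [primorial, prod_filter, prod_range_succ]
    have H17 : primorial (2 * 22 + 1) * ((2 * 22 + 1) * (22 * 22 + 22 - 2)) < 25 ^ 17 := by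
      norm_num [primorial, prod_filter, prod_range_succ]
    have H23 : primorial (2 * 29 + 1) * ((2 * 29 + 1) * (29 * 29 + 29 - 2)) < 25 ^ 23 := by
      norm_num [primorial, prod_filter, prod_range_succ]
    have hcases : (1 ≤ h ∧ h ≤ 1) ∨ (2 ≤ h ∧ h ≤ 2) ∨ (3 ≤ h ∧ h ≤ 3) ∨ (4 ≤ h ∧ h ≤ 4) ∨
        (5 ≤ h ∧ h ≤ 5) ∨ (6 ≤ h ∧ h ≤ 7) ∨ (8 ≤ h ∧ h ≤ 9) ∨ (10 ≤ h ∧ h ≤ 12) ∨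
        (13 ≤ h ∧ h ≤ 16) ∨ (17 ≤ h ∧ h ≤ 22) ∨ (23 ≤ h ∧ h ≤ 29) := by omega
    rcases hcases with ⟨ha, hb⟩ | ⟨ha, hb⟩ | ⟨ha, hb⟩ | ⟨ha, hb⟩ | ⟨ha, hb⟩ | ⟨ha, hb⟩ |
      ⟨ha, hb⟩ | ⟨ha, hb⟩ | ⟨ha, hb⟩ | ⟨ha, hb⟩ | ⟨ha, hb⟩
    · exact key H1 ha hb
    · exact key H2 ha hb
    · exact key H3 ha hb
    · exact key H4 ha hb
    · exact key H5 ha hb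
    · exact key H6 ha hb
    · exact key H8 ha hb
    · exact key H10 ha hb
    · exact key H13 ha hb
    · exact key H17 ha hb
    · exact key H23 ha hb
  · have key : 4 ^ (2 * h + 1) * ((2 * h + 1) * (h * h + h)) < 25 ^ h := by
      induction h, hge using Nat.le_induction with
      | base => norm_num
      | succ n hn ih =>
        have ih := ih (by omega)
        have h1 : 16 * ((2 * (n + 1) + 1) * ((n + 1) * (n + 1) + (n + 1)))
            ≤ 25 * ((2 * n + 1) * (n * n + n)) := by nlinarith
        calc 4 ^ (2 * (n + 1) + 1) * ((2 * (n + 1) + 1) * ((n + 1) * (n + 1) + (n + 1)))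
            = 4 ^ (2 * n + 1) * (16 * ((2 * (n + 1) + 1) * ((n + 1) * (n + 1) + (n + 1)))) := by
              ring
          _ ≤ 4 ^ (2 * n + 1) * (25 * ((2 * n + 1) * (n * n + n))) := by gcongr
          _ = 25 * (4 ^ (2 * n + 1) * ((2 * n + 1) * (n * n + n))) := by ring
          _ < 25 * 25 ^ n := by omega
          _ = 25 ^ (n + 1) := by ring
    calc _ ≤ 4 ^ (2 * h + 1) * ((2 * h + 1) * (h * h + h)) := by
          gcongr
          · exact primorial_le_four_pow _
          · omega
      _ < _ := key

theorem sum_sub_one_add_two_le {W : Finset ℕ} {h : ℕ} (hh : 1 ≤ h)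
    (hW : ∀ r ∈ W, Odd r ∧ 5 ≤ r ∧ r ≤ 2 * h + 1) :
    ∑ r ∈ W, (r - 1) + 2 ≤ h * h + h := by
  have hsub : W ⊆ (Icc 2 h).image (fun i => 2 * i + 1) := by
    intro r hr
    obtain ⟨⟨k, rfl⟩, h5, hle⟩ := hW r hr
    exact mem_image.2 ⟨k, mem_Icc.2 (by omega), rfl⟩
  have h1 : ∑ r ∈ W, (r - 1) ≤ ∑ i ∈ Icc 2 h, 2 * i := by
    refine (sum_le_sum_of_subset hsub).trans ?_
    rw [sum_image (by intro a _ b _ hab; simpa using hab)]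
    simp
  have h2 : ∑ i ∈ Icc 2 h, 2 * i + 2 = h * h + h := by
    clear hW hsub h1
    induction h, hh using Nat.le_induction with
    | base => simp
    | succ n hn ih =>
      rw [sum_Icc_succ_top (by omega)]
      nlinarith
  omega

/-- Distinct primes `r ≥ 5` whose geometric sums all equal the same prime `p` cannot satisfy the
congruence `∑ (r - 1) (1 - 1 / d r) ≡ 1 / 2` modulo `p`. -/
theorem not_dvd_of_geomSum_eq_prime {p : ℕ} (hp : p.Prime) {S : Finset ℕ} {d : ℕ → ℕ}
    (hS : ∀ r ∈ S, r.Prime ∧ 5 ≤ r) (hd : ∀ r ∈ S, Odd (d r) ∧ 1 < d r)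
    (hsum : ∀ r ∈ S, ∑ i ∈ range (d r), r ^ i = p) :
    ¬ (p : ℤ) ∣ 2 * ((∑ r ∈ S, (r - 1) * ((d r - 1) * ∏ s ∈ S.erase r, d s) : ℕ) : ℤ)
      - ((∏ r ∈ S, d r : ℕ) : ℤ) := by
  intro hdvd
  rcases S.eq_empty_or_nonempty with rfl | hne
  · have h1 : (p : ℤ) ∣ ((1 : ℕ) : ℤ) := by simpa using hdvd
    exact hp.one_lt.ne' (Nat.dvd_one.1 (Int.natCast_dvd_natCast.1 h1))
  set D := ∏ r ∈ S, d r with hD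
  set T := ∑ r ∈ S, (r - 1) * ((d r - 1) * ∏ s ∈ S.erase r, d s) with hT
  have hdp : ∀ r ∈ S, (d r).Prime := fun r hr =>
    prime_of_geomSum_prime (le_trans (by norm_num) (hS r hr).2) (by rw [hsum r hr]; exact hp)
  have hDr : ∀ r ∈ S, d r * ∏ s ∈ S.erase r, d s = D := fun r hr => mul_prod_erase S d hr
  have hinj : Set.InjOn d S := by
    intro r hr s hs hrs
    have hlt : ∀ x ∈ S, ∀ y ∈ S, d x = d y → ¬ x < y := by
      intro x hx y hy hxy hlt
      have h1 : ∑ i ∈ range (d x), x ^ i < ∑ i ∈ range (d x), y ^ i :=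
        sum_lt_sum (fun i _ => Nat.pow_le_pow_left hlt.le i)
          ⟨1, mem_range.2 (hd x hx).2, by simpa using hlt⟩
      rw [hsum x hx, hxy, hsum y hy] at h1
      exact lt_irrefl _ h1
    have h1 := hlt r hr s hs hrs
    have h2 := hlt s hs r hr hrs.symm
    omega
  have hDimg : ∏ x ∈ S.image d, x = D := prod_image hinj
  -- the term of any one index already exceeds `D`, so the multiple of `p` is positive
  have hDT : D < 2 * T := by
    obtain ⟨r, hr⟩ := hne
    have h1 : (r - 1) * ((d r - 1) * ∏ s ∈ S.erase r, d s) ≤ T :=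
      single_le_sum (f := fun r => (r - 1) * ((d r - 1) * ∏ s ∈ S.erase r, d s))
        (fun _ _ => Nat.zero_le _) hr
    have h2 : 0 < ∏ s ∈ S.erase r, d s := prod_pos fun s hs => (hdp s (mem_of_mem_erase hs)).pos
    have h3 : 4 ≤ r - 1 := by have := hS r hr; omega
    have h4 : d r < 2 * (4 * (d r - 1)) := by have := hd r hr; omega
    calc D = d r * ∏ s ∈ S.erase r, d s := (hDr r hr).symm
      _ < 2 * (4 * (d r - 1)) * ∏ s ∈ S.erase r, d s := by gcongr
      _ = 2 * (4 * ((d r - 1) * ∏ s ∈ S.erase r, d s)) := by ring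
      _ ≤ 2 * ((r - 1) * ((d r - 1) * ∏ s ∈ S.erase r, d s)) := by gcongr
      _ ≤ 2 * T := by omega
  have hpT : p + D ≤ 2 * T := by
    have := Int.le_of_dvd (by omega) hdvd
    omega
  obtain ⟨r₀, hr₀, hmax⟩ := exists_max_image S d hne
  obtain ⟨h, hh⟩ := (hd r₀ hr₀).1
  have hh1 : 1 ≤ h := by have := (hd r₀ hr₀).2; omega
  have h25 : 25 ^ h ≤ p := by
    calc 25 ^ h = 5 ^ (2 * h) := by rw [pow_mul]; norm_num
      _ ≤ r₀ ^ (2 * h) := Nat.pow_le_pow_left (hS r₀ hr₀).2 _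
      _ ≤ ∑ i ∈ range (d r₀), r₀ ^ i :=
        single_le_sum (f := fun i => r₀ ^ i) (fun _ _ => Nat.zero_le _)
          (mem_range.2 (by omega))
      _ = p := hsum r₀ hr₀
  have hD0 : 0 < D := prod_pos fun r hr => (hdp r hr).pos
  have hodd : ∀ r ∈ S, d r ≠ 2 := fun r hr h2 => by
    have := (hd r hr).1; rw [h2] at this; exact absurd this (by decide)
  have h2img : 2 ∉ S.image d := fun h2 => by
    obtain ⟨r, hr, h2⟩ := mem_image.1 h2
    exact hodd r hr h2
  have hprim : 2 * D ≤ primorial (2 * h + 1) := by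
    rw [← hDimg, ← prod_insert (f := fun x => x) h2img, primorial]
    refine prod_le_prod_of_subset_of_one_le' ?_ ?_
    · intro x hx
      rcases mem_insert.1 hx with rfl | hx
      · exact mem_filter.2 ⟨mem_range.2 (by omega), Nat.prime_two⟩
      · obtain ⟨r, hr, rfl⟩ := mem_image.1 hx
        exact mem_filter.2 ⟨mem_range.2 (by have := hmax r hr; omega), hdp r hr⟩
    · intro x hx _
      exact (mem_filter.1 hx).2.one_le
  set V := S.filter (fun r => 2 * h + 1 < r) with hV
  set W := S.filter (fun r => ¬ 2 * h + 1 < r) with hW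
  have hWsum : ∑ r ∈ W, (r - 1) + 2 ≤ h * h + h := by
    refine sum_sub_one_add_two_le hh1 fun r hr => ?_
    obtain ⟨hrS, hr⟩ := mem_filter.1 hr
    exact ⟨(hS r hrS).1.odd_of_ne_two (by have := hS r hrS; omega), (hS r hrS).2, by omega⟩
  set M := ∑ r ∈ W, (r - 1) with hM
  have hnum : 2 * D * ((2 * h + 1) * M) < p := by
    calc 2 * D * ((2 * h + 1) * M)
        ≤ primorial (2 * h + 1) * ((2 * h + 1) * (h * h + h - 2)) := by gcongr; omega
      _ < 25 ^ h := primorial_mul_lt_pow hh1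
      _ ≤ p := h25
  have hVdvd : 2 * D * ∏ r ∈ V, r < p := by
    have hdis : Disjoint (insert 2 (S.image d)) V := by
      rw [disjoint_left]
      intro x hx hxV
      have := (mem_filter.1 hxV).2
      rcases mem_insert.1 hx with rfl | hx
      · omega
      · obtain ⟨r, hr, rfl⟩ := mem_image.1 hx
        have := hmax r hr
        omega
    have h1 : ∏ x ∈ insert 2 (S.image d) ∪ V, x ∣ p - 1 := by
      refine prod_primes_dvd _ ?_ ?_
      · intro x hx
        rcases mem_union.1 hx with hx | hx
        · rcases mem_insert.1 hx with rfl | hx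
          · exact Nat.prime_two.prime
          · obtain ⟨r, hr, rfl⟩ := mem_image.1 hx
            exact (hdp r hr).prime
        · exact (hS x (mem_filter.1 hx).1).1.prime
      · intro x hx
        rcases mem_union.1 hx with hx | hx
        · rcases mem_insert.1 hx with rfl | hx
          · have h5 : 25 ^ 1 ≤ p := (Nat.pow_le_pow_right (by norm_num) hh1).trans h25
            have := hp.eq_two_or_odd
            omega
          · obtain ⟨r, hr, rfl⟩ := mem_image.1 hx
            exact dvd_sub_one_of_geomSum_eq_prime (by have := hS r hr; omega) hp (hsum r hr)
        · have hxS := (mem_filter.1 hx).1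
          have h2 := hsum x hxS
          rw [← Nat.sub_add_cancel (hd x hxS).2.le, sum_range_succ', pow_zero] at h2
          rw [← h2, Nat.add_sub_cancel]
          exact dvd_sum fun i _ => dvd_pow_self x (Nat.succ_ne_zero i)
    rw [prod_union hdis, prod_insert h2img, hDimg] at h1
    have := Nat.le_of_dvd (by have := hp.one_lt; omega) h1
    have := hp.one_lt
    omega
  have hterm : ∀ r ∈ S, (r - 1) * ((d r - 1) * ∏ s ∈ S.erase r, d s) ≤ (r - 1) * D := by
    intro r hr
    rw [← hDr r hr]
    gcongr
    omega
  have hsplit : T = ∑ r ∈ V, (r - 1) * ((d r - 1) * ∏ s ∈ S.erase r, d s)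
      + ∑ r ∈ W, (r - 1) * ((d r - 1) * ∏ s ∈ S.erase r, d s) :=
    (sum_filter_add_sum_filter_not _ _ _).symm
  have hTW : ∑ r ∈ W, (r - 1) * ((d r - 1) * ∏ s ∈ S.erase r, d s) ≤ M * D := by
    rw [hM, sum_mul]
    exact sum_le_sum fun r hr => hterm r (mem_filter.1 hr).1
  have hTV : ∑ r ∈ V, (r - 1) * ((d r - 1) * ∏ s ∈ S.erase r, d s) ≤ (∑ r ∈ V, (r - 1)) * D := by
    rw [sum_mul]
    exact sum_le_sum fun r hr => hterm r (mem_filter.1 hr).1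
  rcases V.eq_empty_or_nonempty with hVe | ⟨r, hrV⟩
  · rw [hVe, sum_empty, zero_add] at hsplit
    nlinarith only [hsplit, hTW, hpT, hnum, hD0, Nat.zero_le (D * M * h)]
  obtain ⟨hrS, hrΔ⟩ := mem_filter.1 hrV
  rcases (V.erase r).eq_empty_or_nonempty with hVe | ⟨s, hs⟩
  · have hV1 : V = {r} := by rw [← insert_erase hrV, hVe]; rfl
    rw [hV1, prod_singleton] at hVdvd
    rw [hV1, sum_singleton] at hsplit
    set d₁ := d r with hd₁
    have hd₁Δ : d₁ ≤ 2 * h + 1 := by have := hmax r hrS; omega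
    have hd₁pos : 0 < d₁ := (hdp r hrS).pos
    have h1 : d₁ * T ≤ D * ((r - 1) * (d₁ - 1) + d₁ * M) := by
      calc d₁ * T = (r - 1) * (d₁ - 1) * (d₁ * ∏ s ∈ S.erase r, d s)
            + d₁ * ∑ r ∈ W, (r - 1) * ((d r - 1) * ∏ s ∈ S.erase r, d s) := by
            rw [hsplit]; ring
        _ ≤ (r - 1) * (d₁ - 1) * D + d₁ * (M * D) := by
            rw [hDr r hrS]; gcongr
        _ = _ := by ring
    obtain ⟨e, he⟩ : ∃ e, d₁ = e + 1 := ⟨d₁ - 1, by omega⟩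
    obtain ⟨x, rfl⟩ : ∃ x, r = x + 1 := ⟨r - 1, by omega⟩
    rcases le_or_gt (d₁ * M) (x + 1) with hc | hc
    · have h2 : d₁ * T ≤ d₁ * (D * (x + 1)) := by
        refine h1.trans ?_
        rw [he, mul_left_comm]
        gcongr
        simp only [Nat.add_sub_cancel]
        rw [he] at hc
        nlinarith only [hc, Nat.zero_le e]
      have := Nat.le_of_mul_le_mul_left h2 hd₁pos
      nlinarith only [this, hVdvd, hpT]
    · have h2 : d₁ * T ≤ d₁ * (D * (d₁ * M)) := by
        refine h1.trans ?_
        rw [mul_left_comm]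
        gcongr
        rw [he] at hc ⊢
        simp only [Nat.add_sub_cancel]
        nlinarith only [Nat.mul_le_mul_left e hc.le]
      have h3 := Nat.le_of_mul_le_mul_left h2 hd₁pos
      have h4 : D * (d₁ * M) ≤ D * ((2 * h + 1) * M) := by gcongr
      nlinarith only [h3, h4, hnum, hpT]
  · have hs' := mem_filter.1 (mem_of_mem_erase hs)
    have hVpos : ∀ x ∈ V, 1 ≤ x := fun x hx => (hS x (mem_filter.1 hx).1).1.one_le
    have hle : ∀ U : Finset ℕ, (∀ x ∈ U, 5 ≤ x) → ∑ x ∈ U, (x - 1) + 1 ≤ ∏ x ∈ U, x := by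
      intro U hU
      induction U using Finset.induction_on with
      | empty => simp
      | insert a U ha ih =>
        rw [sum_insert ha, prod_insert ha]
        have h1 := ih fun x hx => hU x (mem_insert_of_mem hx)
        have h2 := hU a (mem_insert_self a U)
        obtain ⟨b, rfl⟩ : ∃ b, a = b + 1 := ⟨a - 1, by omega⟩
        simp only [Nat.add_sub_cancel]
        have h3 : b ≤ b * ∏ x ∈ U, x := Nat.le_mul_of_pos_right b (by omega)
        rw [add_one_mul]
        omega
    have h1 := hle (V.erase r) fun x hx => (hS x (mem_filter.1 (mem_of_mem_erase hx)).1).2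
    have h2 : s ≤ ∏ x ∈ V.erase r, x :=
      Nat.le_of_dvd (prod_pos fun x hx => hVpos x (mem_of_mem_erase hx)) (dvd_prod_of_mem _ hs)
    have h3 := hVdvd
    rw [← mul_prod_erase V (fun x => x) hrV] at h3
    rw [← add_sum_erase V (fun x => x - 1) hrV] at hTV
    set P := ∏ x ∈ V.erase r, x with hP
    set Q := ∑ x ∈ V.erase r, (x - 1) with hQ
    have hr5 := (hS r hrS).2
    have hs5 := (hS s hs'.1).2
    have h4 : (r - 1 + Q) + M ≤ r * P := by
      have hrP : (2 * h + 2) * (2 * h + 2) ≤ r * P := Nat.mul_le_mul hrΔ (by omega)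
      have hP5 : 5 ≤ P := by omega
      have h5 : 4 * (r + P) ≤ 3 * (r * P) := by nlinarith only [hr5, hP5]
      have h6 : 4 * M ≤ r * P := by nlinarith only [hrP, hWsum]
      omega
    have h6 : T ≤ D * (r * P) := by
      calc T ≤ (r - 1 + Q) * D + M * D := by rw [hsplit]; exact add_le_add hTV hTW
        _ = D * ((r - 1 + Q) + M) := by ring
        _ ≤ D * (r * P) := by gcongr
    have h7 : 2 * D * (r * P) = 2 * (D * (r * P)) := by ring
    omega

theorem one_add_mul_pow_of_sq_eq_zero {R : Type*} [CommRing R] {ε : R} (hε : ε ^ 2 = 0) (y : R)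
    (m : ℕ) : (1 + ε * y) ^ m = 1 + ε * (y * m) := by
  induction m with
  | zero => simp
  | succ m ih =>
    rw [pow_succ, ih]
    push_cast
    linear_combination (y * y * m) * hε

theorem prod_one_add_mul_of_sq_eq_zero {R ι : Type*} [CommRing R] {ε : R} (hε : ε ^ 2 = 0)
    (s : Finset ι) (y : ι → R) : ∏ i ∈ s, (1 + ε * y i) = 1 + ε * ∑ i ∈ s, y i := by
  classical
  induction s using Finset.induction_on with
  | empty => simp
  | insert a s ha ih =>
    rw [prod_insert ha, ih, sum_insert ha]
    linear_combination (y a * ∑ i ∈ s, y i) * hε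

theorem two_mul_two_add_pow_of_sq_eq_zero {R : Type*} [CommRing R] {ε : R} (hε : ε ^ 2 = 0)
    (m : ℕ) : 2 * (2 + ε) ^ m = 2 ^ m * (2 + ε * m) := by
  induction m with
  | zero => simp
  | succ m ih =>
    rw [pow_succ, ← mul_assoc, ih]
    push_cast
    linear_combination (2 ^ m * (m : R)) * hε

theorem sigma_one_eq_prod_geomSum {n : ℕ} (hn : n ≠ 0) :
    ArithmeticFunction.sigma 1 n
      = ∏ r ∈ n.primeFactors, ∑ i ∈ range (n.factorization r + 1), r ^ i := by
  rw [ArithmeticFunction.IsMultiplicative.multiplicative_factorization _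
    ArithmeticFunction.isMultiplicative_sigma hn]
  exact prod_congr (Nat.support_factorization n) fun r hr =>
    ArithmeticFunction.sigma_one_apply_prime_pow (Nat.prime_of_mem_primeFactors (by simpa using hr))

/-- If `σ(w²)` is a power of a prime `p` and all primes dividing `w` are at least `5`, then
`2w²` is not congruent to `2 + p` modulo `p²`. -/
theorem two_mul_sq_ne_of_sigma_sq_eq_prime_pow {p m w : ℕ} (hp : p.Prime) (hp2 : Odd p)
    (hw : w ≠ 0) (hw5 : ∀ r : ℕ, r.Prime → r ∣ w → 5 ≤ r)
    (hsig : ArithmeticFunction.sigma 1 (w ^ 2) = p ^ m) :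
    ((2 * w ^ 2 : ℕ) : ZMod (p ^ 2)) ≠ 2 + p := by
  intro hmod
  set S := w.primeFactors with hS
  set d : ℕ → ℕ := fun r => 2 * w.factorization r + 1 with hd
  set g : ℕ → ℕ := fun r => ∑ i ∈ range (d r), r ^ i with hg
  have hprod : ∏ r ∈ S, g r = p ^ m := by
    rw [← hsig, sigma_one_eq_prod_geomSum (pow_ne_zero 2 hw), Nat.primeFactors_pow w two_ne_zero]
    refine prod_congr rfl fun r _ => ?_
    simp [hg, hd]
  have hSprime : ∀ r ∈ S, r.Prime ∧ 5 ≤ r := fun r hr =>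
    ⟨Nat.prime_of_mem_primeFactors hr,
      hw5 r (Nat.prime_of_mem_primeFactors hr) (Nat.dvd_of_mem_primeFactors hr)⟩
  have hd1 : ∀ r ∈ S, 1 < d r := fun r hr => by
    have := (Nat.prime_of_mem_primeFactors hr).factorization_pos_of_dvd hw
      (Nat.dvd_of_mem_primeFactors hr)
    simp only [hd]
    omega
  have hgpow : ∀ r ∈ S, ∃ j, g r = p ^ (j + 1) := by
    intro r hr
    obtain ⟨j, -, hj⟩ := (Nat.dvd_prime_pow hp).1 (hprod ▸ dvd_prod_of_mem g hr)
    have h1 : ∑ i ∈ range 2, r ^ i ≤ g r :=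
      sum_le_sum_of_subset (range_subset_range.2 (hd1 r hr))
    have hj0 : j ≠ 0 := by
      rintro rfl
      have := hSprime r hr
      rw [hj] at h1
      simp [sum_range_succ] at h1
      omega
    exact ⟨j - 1, by rw [hj, Nat.sub_add_cancel (by omega)]⟩
  choose! j hj using hgpow
  set E := ∏ r ∈ S, d r with hE
  set E' : ℕ → ℕ := fun r => ∏ s ∈ S.erase r, d s with hE'
  set y : ℕ → ℕ := fun r => (r - 1) * p ^ j r with hy
  have hEr : ∀ r ∈ S, d r * E' r = E := fun r hr => mul_prod_erase S d hr
  have hε : ((p : ZMod (p ^ 2))) ^ 2 = 0 := by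
    have := ZMod.natCast_self (p ^ 2)
    exact_mod_cast this
  have hrd : ∀ r ∈ S, (r : ZMod (p ^ 2)) ^ d r = 1 + p * (y r : ZMod (p ^ 2)) := by
    intro r hr
    have h1 := geom_sum_mul (r : ZMod (p ^ 2)) (d r)
    have h2 : ∑ i ∈ range (d r), (r : ZMod (p ^ 2)) ^ i = (p : ZMod (p ^ 2)) ^ (j r + 1) := by
      have := congrArg (Nat.cast : ℕ → ZMod (p ^ 2)) (hj r hr)
      simpa [hg] using this
    have h3 : (y r : ZMod (p ^ 2)) = ((r : ZMod (p ^ 2)) - 1) * (p : ZMod (p ^ 2)) ^ j r := by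
      simp only [hy, Nat.cast_mul, Nat.cast_pow, Nat.cast_sub (hSprime r hr).1.one_le, Nat.cast_one]
    rw [h2] at h1
    rw [h3]
    linear_combination -h1
  have hwE : ((w : ZMod (p ^ 2)) ^ 2) ^ E
      = 1 + p * ∑ r ∈ S, (y r : ZMod (p ^ 2)) * ((d r - 1) * E' r : ℕ) := by
    have h1 : w = ∏ r ∈ S, r ^ w.factorization r := (Nat.prod_factorization_pow_eq_self hw).symm
    have h2 : (w : ZMod (p ^ 2)) = ∏ r ∈ S, (r : ZMod (p ^ 2)) ^ w.factorization r := by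
      conv_lhs => rw [h1]
      push_cast
      rfl
    rw [h2, ← prod_pow, ← prod_pow, ← prod_one_add_mul_of_sq_eq_zero hε]
    refine prod_congr rfl fun r hr => ?_
    rw [← one_add_mul_pow_of_sq_eq_zero hε, ← hrd r hr, ← pow_mul, ← pow_mul, ← pow_mul,
      ← hEr r hr]
    congr 1
    simp only [hd, Nat.add_sub_cancel]
    ring
  set T := ∑ r ∈ S, y r * ((d r - 1) * E' r) with hT
  have hkey : ((p * (2 ^ E * (2 * T - E)) : ℤ) : ZMod (p ^ 2)) = 0 := by
    have h1 := two_mul_two_add_pow_of_sq_eq_zero hε E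
    rw [← hmod] at h1
    push_cast at h1
    rw [mul_pow, hwE] at h1
    push_cast [hT]
    push_cast at h1
    linear_combination h1
  rw [ZMod.intCast_zmod_eq_zero_iff_dvd] at hkey
  have hpp := Nat.prime_iff_prime_int.1 hp
  have hdvd : (p : ℤ) ∣ 2 * T - E := by
    push_cast at hkey
    rw [pow_two] at hkey
    have h1 := Int.dvd_of_mul_dvd_mul_left (by exact_mod_cast hp.ne_zero) hkey
    refine (hpp.dvd_or_dvd h1).resolve_left fun h2 => ?_
    have h3 : p ∣ 2 := by exact_mod_cast hpp.dvd_of_dvd_pow h2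
    rw [(Nat.prime_dvd_prime_iff_eq hp Nat.prime_two).1 h3] at hp2
    exact absurd hp2 (by decide)
  set A := S.filter (fun r => j r = 0) with hA
  set B := S.filter (fun r => ¬ j r = 0) with hB
  set C := ∏ r ∈ B, d r with hC
  have hEAB : E = (∏ r ∈ A, d r) * C := (prod_filter_mul_prod_filter_not S _ _).symm
  have hpC : ¬ p ∣ C := by
    intro h1
    obtain ⟨r, hr, h2⟩ := (hp.prime.dvd_finsetProd_iff d).1 h1
    have hrS := (mem_filter.1 hr).1
    exact not_dvd_of_geomSum_eq_prime_pow (hSprime r hrS).1.two_le hp hp2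
      (by have := hd1 r hrS; omega) (hj r hrS) h2
  set T' := ∑ r ∈ A, (r - 1) * ((d r - 1) * ∏ s ∈ A.erase r, d s) with hT'
  have hTB : p ∣ ∑ r ∈ B, y r * ((d r - 1) * E' r) := by
    refine dvd_sum fun r hr => Dvd.dvd.mul_right (Dvd.dvd.mul_left ?_ _) _
    exact dvd_pow_self p (mem_filter.1 hr).2
  have hTA : ∑ r ∈ A, y r * ((d r - 1) * E' r) = C * T' := by
    rw [hT', mul_sum]
    refine sum_congr rfl fun r hr => ?_
    obtain ⟨hrS, hr0⟩ := mem_filter.1 hr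
    have h1 : E' r = (∏ s ∈ A.erase r, d s) * C := by
      have h2 : d r * E' r = d r * ((∏ s ∈ A.erase r, d s) * C) := by
        rw [hEr r hrS, hEAB, ← mul_assoc, mul_prod_erase A d hr]
      exact Nat.eq_of_mul_eq_mul_left (by have := hd1 r hrS; omega) h2
    simp only [hy, hr0, pow_zero, h1]
    ring
  have hTsplit : T = C * T' + ∑ r ∈ B, y r * ((d r - 1) * E' r) := by
    rw [← hTA]
    exact (sum_filter_add_sum_filter_not S _ _).symm
  have hfinal : (p : ℤ) ∣ (C : ℤ) * (2 * (T' : ℤ) - ((∏ r ∈ A, d r : ℕ) : ℤ)) := by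
    have h1 : (p : ℤ) ∣ 2 * ((∑ r ∈ B, y r * ((d r - 1) * E' r) : ℕ) : ℤ) :=
      Dvd.dvd.mul_left (Int.natCast_dvd_natCast.2 hTB) 2
    have h2 := dvd_sub hdvd h1
    have h3 : (T : ℤ) = C * T' + (∑ r ∈ B, y r * ((d r - 1) * E' r) : ℕ) := by
      exact_mod_cast hTsplit
    have h4 : (E : ℤ) = (∏ r ∈ A, d r : ℕ) * C := by exact_mod_cast hEAB
    have h5 : (C : ℤ) * (2 * (T' : ℤ) - ((∏ r ∈ A, d r : ℕ) : ℤ))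
        = 2 * T - E - 2 * ((∑ r ∈ B, y r * ((d r - 1) * E' r) : ℕ) : ℤ) := by
      linear_combination h4 - 2 * h3
    rw [h5]
    exact h2
  refine not_dvd_of_geomSum_eq_prime hp (S := A) (d := d)
    (fun r hr => hSprime r (mem_filter.1 hr).1)
    (fun r hr => ⟨⟨_, rfl⟩, hd1 r (mem_filter.1 hr).1⟩)
    (fun r hr => ?_)
    ((hpp.dvd_or_dvd hfinal).resolve_left fun h1 => hpC (Int.natCast_dvd_natCast.1 h1))
  obtain ⟨hrS, hr0⟩ := mem_filter.1 hr
  have := hj r hrS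
  rwa [hr0, zero_add, pow_one] at this

/-- If `q = A c - 1` and `(p - 1) q t + 1 = p A R` with `R ≡ 1` modulo `p - 1`, then
`(p - 2) A < (p - 1) t`. -/
theorem mul_lt_mul_of_mul_add_one_eq {p q t c A R : ℤ} (hp : 5 ≤ p) (hA : 0 < A) (ht : 0 < t)
    (hR : p - 1 ∣ R - 1) (hq : q + 1 = A * c) (h : (p - 1) * (q * t) + 1 = p * (A * R)) :
    (p - 2) * A < (p - 1) * t := by
  obtain ⟨x, hx⟩ := hR
  set j := (p - 1) * (c * t) - p * R with hj
  have h1 : (p - 1) * t - 1 = A * j := by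
    rw [hj]
    linear_combination ((p - 1) * t) * hq - h
  have hj0 : 0 < j := by
    have : 0 < A * j := by nlinarith
    exact pos_of_mul_pos_right this hA.le
  have hdvd : p - 1 ∣ j + 1 := ⟨c * t - R - x, by rw [hj]; linear_combination -hx⟩
  have h2 := Int.le_of_dvd (by omega) hdvd
  nlinarith

theorem sigma_one_prime_pow_add {p : ℕ} (hp : p.Prime) (e : ℕ) :
    ArithmeticFunction.sigma 1 (p ^ e) + p * p ^ e
      = p * ArithmeticFunction.sigma 1 (p ^ e) + 1 := by
  rw [ArithmeticFunction.sigma_one_apply_prime_pow hp, ← pow_succ', ← sum_range_succ,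
    sum_range_succ', pow_zero, mul_sum]
  simp only [pow_succ']

/-- The bound `q < n` for an odd perfect number `q * n ^ 2` with special prime `q` of exponent one
and no prime factor of `n` below `5`. -/
theorem lt_of_succ_mul_sigma_sq_eq {q n : ℕ} (hq : q.Prime) (hn : Odd n)
    (hn5 : ∀ r : ℕ, r.Prime → r ∣ n → 5 ≤ r) (hqodd : Odd q)
    (h : (q + 1) * ArithmeticFunction.sigma 1 (n ^ 2) = 2 * (q * n ^ 2)) : q < n := by
  by_contra! hle
  have hn0 : n ≠ 0 := hn.pos.ne'
  obtain ⟨m, hm⟩ : q ∣ ArithmeticFunction.sigma 1 (n ^ 2) := by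
    refine Nat.Coprime.dvd_of_dvd_mul_left
      (Nat.coprime_self_add_right.2 (Nat.coprime_one_right q)) ?_
    rw [h]
    exact ⟨2 * n ^ 2, by ring⟩
  have hqm : (q + 1) * m = 2 * n ^ 2 := by
    refine Nat.eq_of_mul_eq_mul_left hq.pos ?_
    rw [hm] at h
    linarith
  have hmodd : Odd m := by
    obtain ⟨e, rfl⟩ := hqodd
    have : (e + 1) * m = n ^ 2 := by linarith
    exact Nat.Odd.of_mul_right (this ▸ hn.pow)
  have hm2 : m < 2 * q := by
    by_contra! hge
    nlinarith [Nat.mul_le_mul_left (q + 1) hge, Nat.mul_le_mul hle hle, hq.pos]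
  obtain ⟨p, hpn, hqp⟩ : ∃ p ∈ n.primeFactors,
      q ∣ ArithmeticFunction.sigma 1 (p ^ (2 * n.factorization p)) := by
    have h1 : q ∣ ArithmeticFunction.sigma 1 (n ^ 2) := ⟨m, hm⟩
    rw [sigma_one_eq_prod_geomSum (pow_ne_zero 2 hn0), Nat.primeFactors_pow n two_ne_zero] at h1
    obtain ⟨p, hp, h2⟩ := (hq.prime.dvd_finsetProd_iff _).1 h1
    refine ⟨p, hp, ?_⟩
    rw [ArithmeticFunction.sigma_one_apply_prime_pow (Nat.prime_of_mem_primeFactors hp)]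
    simpa using h2
  have hp := Nat.prime_of_mem_primeFactors hpn
  have hpdvd := Nat.dvd_of_mem_primeFactors hpn
  have hp5 := hn5 p hp hpdvd
  have hpodd : Odd p := hp.odd_of_ne_two (by omega)
  have ha := hp.factorization_pos_of_dvd hn0 hpdvd
  set a := n.factorization p
  obtain ⟨w, hw⟩ : p ^ a ∣ n := Nat.ordProj_dvd n p
  have hpw : ¬ p ∣ w := by
    have := Nat.not_dvd_ordCompl hp hn0
    rwa [Nat.div_eq_of_eq_mul_right (pow_pos hp.pos _) hw] at this
  have hw0 : w ≠ 0 := by rintro rfl; simp at hpw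
  have hwn : w ∣ n := Dvd.intro_left _ hw.symm
  have hn2 : n ^ 2 = p ^ (2 * a) * w ^ 2 := by rw [hw]; ring
  have hcop : (p ^ (2 * a)).Coprime (w ^ 2) :=
    Nat.Coprime.pow _ _ ((Nat.Prime.coprime_iff_not_dvd hp).2 hpw)
  obtain ⟨t, ht⟩ := hqp
  have htm : t * ArithmeticFunction.sigma 1 (w ^ 2) = m := by
    refine Nat.eq_of_mul_eq_mul_left hq.pos ?_
    rw [← hm, hn2, ArithmeticFunction.isMultiplicative_sigma.map_mul_of_coprime hcop, ht, mul_assoc]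
  have hG := sigma_one_prime_pow_add hp (2 * a)
  rw [ht] at hG
  have hpt : ¬ p ∣ t := by
    rintro ⟨y, rfl⟩
    have h1 : p ∣ p * (q * (p * y)) + 1 := by
      rw [← hG]
      exact ⟨q * y + p ^ (2 * a), by ring⟩
    have h2 := (Nat.dvd_add_right (dvd_mul_right p _)).1 h1
    exact hp.one_lt.ne' (Nat.dvd_one.1 h2)
  have htodd : Odd t := Nat.Odd.of_mul_left (htm ▸ hmodd)
  obtain ⟨b, c, hpc, hbc⟩ := Nat.exists_eq_pow_mul_and_not_dvd (n := q + 1) (by omega) p hp.ne_one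
  have hp2w : ¬ p ∣ 2 * w ^ 2 := by
    intro h1
    rcases hp.dvd_mul.1 h1 with h2 | h2
    · have := Nat.le_of_dvd two_pos h2
      omega
    · exact hpw (hp.dvd_of_dvd_pow h2)
  have hval : p ^ b * (c * t * ArithmeticFunction.sigma 1 (w ^ 2)) = p ^ (2 * a) * (2 * w ^ 2) := by
    rw [← htm, hn2, hbc] at hqm
    linarith
  have hb : b ≤ 2 * a := by
    have h1 : p ^ b ∣ p ^ (2 * a) :=
      (((Nat.Prime.coprime_iff_not_dvd hp).2 hp2w).pow_left b).dvd_of_dvd_mul_right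
        ⟨_, hval.symm⟩
    exact (Nat.pow_dvd_pow_iff_le_right hp.one_lt).1 h1
  set A := p ^ b with hA
  set R := p ^ (2 * a - b) with hR
  have hAR : p ^ (2 * a) = A * R := by rw [hA, hR, ← pow_add, Nat.add_sub_cancel' hb]
  have hApos : 0 < A := pow_pos hp.pos _
  have hRpos : 0 < R := pow_pos hp.pos _
  have hval' : c * t * ArithmeticFunction.sigma 1 (w ^ 2) = R * (2 * w ^ 2) := by
    refine Nat.eq_of_mul_eq_mul_left hApos ?_
    rw [hval, hAR, mul_assoc]
  obtain ⟨s, hs⟩ : R ∣ ArithmeticFunction.sigma 1 (w ^ 2) := by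
    have h1 : p.Coprime (c * t) :=
      ((Nat.Prime.coprime_iff_not_dvd hp).2 hpc).mul_right
        ((Nat.Prime.coprime_iff_not_dvd hp).2 hpt)
    exact (h1.pow_left _).dvd_of_dvd_mul_left ⟨_, hval'⟩
  have hsodd : Odd s := by
    rw [hs, ← mul_assoc] at htm
    exact Nat.Odd.of_mul_right (htm ▸ hmodd)
  have hcts : c * t * s = 2 * w ^ 2 := by
    refine Nat.eq_of_mul_eq_mul_left hRpos ?_
    rw [← hval', hs]
    ring
  have htpos := htodd.pos
  have hspos := hsodd.pos
  rw [hAR] at hG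
  have h45 : 4 * (q * t) < 5 * (A * R) := by
    obtain ⟨x, rfl⟩ : ∃ x, p = x + 5 := ⟨p - 5, by omega⟩
    by_contra! hge
    nlinarith only [Nat.mul_le_mul_left (x + 4) hge, hG, Nat.zero_le (x * (A * R))]
  have hts : 2 * (t * t * s) < 5 * A := by
    rw [← htm, hs] at hm2
    have h1 : R * (2 * (t * t * s)) < R * (5 * A) := by
      nlinarith only [Nat.mul_lt_mul_of_pos_left hm2 htpos, h45]
    exact Nat.lt_of_mul_lt_mul_left h1
  rcases Nat.eq_zero_or_pos b with rfl | hb0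
  · have hA1 : A = 1 := pow_zero p
    rw [hA1] at hts hbc hAR
    obtain rfl : t = 1 := by
      by_contra hne
      have : 3 ≤ t := by obtain ⟨y, rfl⟩ := htodd; omega
      nlinarith only [Nat.mul_le_mul this this, Nat.le_mul_of_pos_right (t * t) hspos, hts]
    obtain rfl : s = 1 := by obtain ⟨y, rfl⟩ := hsodd; omega
    refine two_mul_sq_ne_of_sigma_sq_eq_prime_pow hp hpodd hw0
      (fun r hr hrw => hn5 r hr (hrw.trans hwn)) (m := 2 * a) (by rw [hs, hAR]; ring) ?_
    rw [← hcts, mul_one, mul_one, ← one_mul c, ← hbc]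
    have h1 : q = ∑ i ∈ range (2 * a + 1), p ^ i := by
      rw [← ArithmeticFunction.sigma_one_apply_prime_pow hp, ht, mul_one]
    obtain ⟨e, he⟩ : ∃ e, 2 * a + 1 = 2 + e := ⟨2 * a - 1, by omega⟩
    have h2 : q + 1 = 2 + p + p ^ 2 * ∑ i ∈ range e, p ^ i := by
      rw [h1, he, sum_range_add, sum_range_succ, sum_range_one]
      simp only [pow_add, ← mul_sum]
      ring
    rw [h2, Nat.cast_add, Nat.cast_mul, ZMod.natCast_self, zero_mul, add_zero]
    push_cast
    rfl
  · have hA5 : 5 ≤ A := hp5.trans (Nat.le_self_pow hb0.ne' p)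
    have h1 : ((p : ℤ) - 2) * A < (p - 1) * t := by
      refine mul_lt_mul_of_mul_add_one_eq (q := q) (c := c) (R := R) (by exact_mod_cast hp5)
        (by exact_mod_cast hApos) (by exact_mod_cast htpos) ?_ (by exact_mod_cast hbc) ?_
      · rw [hR]
        push_cast
        exact sub_one_dvd_pow_sub_one _ _
      · zify at hG
        linear_combination -hG
    have h2 : 3 * A < 4 * t := by
      zify
      by_contra! hge
      have hp5' : (5 : ℤ) ≤ p := by exact_mod_cast hp5
      nlinarith only [h1, mul_le_mul_of_nonneg_left hge (by omega : (0 : ℤ) ≤ p - 1),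
        mul_nonneg (sub_nonneg.2 hp5') (Int.natCast_nonneg A)]
    have h3 : t * t ≤ t * t * s := Nat.le_mul_of_pos_right _ hspos
    nlinarith only [Nat.mul_lt_mul'' h2 h2, h3, hts, Nat.mul_le_mul_left A hA5]

end OddPerfect

theorem stmt_16 (N q k n : ℕ) (hodd : Odd N) (hperf : ArithmeticFunction.sigma 1 N = 2 * N)
    (hq : q.Prime) (hq4 : q % 4 = 1) (hk4 : k % 4 = 1)
    (hgcd : Nat.gcd q n = 1) (hN : N = q ^ k * n ^ 2)
    (hu : ∀ p : ℕ, p.Prime → p ∣ N → 5 ≤ p) :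
    q < n := by
  subst hN
  have hcop : (q ^ k).Coprime (n ^ 2) := Nat.Coprime.pow _ _ hgcd
  rw [ArithmeticFunction.isMultiplicative_sigma.map_mul_of_coprime hcop] at hperf
  have hn : Odd n := by
    have h1 := Nat.Odd.of_mul_right hodd
    exact (Nat.odd_pow_iff two_ne_zero).1 h1
  by_cases hk : k = 1
  · subst hk
    rw [pow_one] at *
    refine OddPerfect.lt_of_succ_mul_sigma_sq_eq hq hn (fun r hr hrn => hu r hr ?_)
      (hq.odd_of_ne_two (by rintro rfl; omega)) ?_
    · exact (hrn.trans (dvd_pow_self n two_ne_zero)).mul_left _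
    · rw [← hperf]
      congr 1
      simpa [Finset.sum_range_succ, add_comm] using
        (ArithmeticFunction.sigma_one_apply_prime_pow (i := 1) hq).symm
  · have hk5 : 5 ≤ k := by omega
    have hdvd : q ^ k ∣ ArithmeticFunction.sigma 1 (n ^ 2) := by
      have h1 : q.Coprime (ArithmeticFunction.sigma 1 (q ^ k)) := by
        have h2 := OddPerfect.sigma_one_prime_pow_add hq k
        rw [Nat.Prime.coprime_iff_not_dvd hq]
        intro h3
        have h4 : q ∣ q * ArithmeticFunction.sigma 1 (q ^ k) + 1 := by
          rw [← h2]
          exact dvd_add h3 (dvd_mul_right _ _)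
        exact hq.one_lt.ne' (Nat.dvd_one.1 ((Nat.dvd_add_right (dvd_mul_right q _)).1 h4))
      refine (h1.pow_left k).dvd_of_dvd_mul_left ?_
      rw [hperf]
      exact ⟨2 * n ^ 2, by ring⟩
    have hle : q ^ k ≤ 2 * n ^ 2 := by
      have hpos : 0 < q ^ k := pow_pos hq.pos k
      have hσ : q ^ k ≤ ArithmeticFunction.sigma 1 (q ^ k) := by
        rw [ArithmeticFunction.sigma_one_apply_prime_pow hq, Finset.sum_range_succ]
        exact Nat.le_add_left _ _
      have h2 := Nat.le_of_dvd (ArithmeticFunction.sigma_pos_iff.2 (pow_pos hn.pos 2)) hdvd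
      refine Nat.le_of_mul_le_mul_left (?_ : q ^ k * q ^ k ≤ q ^ k * (2 * n ^ 2)) hpos
      calc q ^ k * q ^ k ≤ _ := Nat.mul_le_mul hσ h2
        _ = q ^ k * (2 * n ^ 2) := by rw [hperf]; ring
    by_contra! hnq
    have h3 : q ^ 5 ≤ q ^ k := Nat.pow_le_pow_right hq.pos hk5
    have h4 : n ^ 2 ≤ q ^ 2 := Nat.pow_le_pow_left hnq 2
    have h5 : 2 * q ^ 2 < q ^ 5 := by
      have := hq.two_le
      calc 2 * q ^ 2 < 8 * q ^ 2 := by have := pow_pos hq.pos 2; omega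
        _ ≤ q ^ 3 * q ^ 2 := Nat.mul_le_mul_right _ (Nat.pow_le_pow_left this 3)
        _ = q ^ 5 := by ring
    omega
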